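/- There is an absolute constant C > 0 such that the following holds. Let n, m ≥ 2 and let v̄_1, …, v̄_m ∈ ℝ^n be unit vectors. Let P be the random-bias vector P := (1/(10√(m log n))) ∑_{ℓ=1}^m ∑_{j ∈ J_ℓ} α_{ℓj} 2^j v̄_ℓ^{(j)} (with α_{ℓj} independent uniform on [-1,1] and v̄_ℓ = ∑_{j∈J_ℓ} v̄_ℓ^{(j)} the binary decomposition of v̄_ℓ), conditioned on the event ‖P‖_∞ ≤ 1/2. Let x ~ μ_P. Then for v = v̄_1 and every t ∈ ℝ, ∑_{k=1}^n Pr[|⟨v,x⟩ - t| < 2|v_k|] ≤ C · √m · (log n)^2, where the probability is over both P and x ~ μ_P. -/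

import Mathlib

open MeasureTheory
open scoped Classical

/-- The dyadic class `K(j)` of the binary decomposition of `v`: the set of coordinates
`k` with `2^{-j-1} < |v k| ≤ 2^{-j}`. -/
noncomputable def binClass {n : ℕ} (v : Fin n → ℝ) (j : ℤ) : Finset (Fin n) :=
  Finset.univ.filter fun k => (2 : ℝ) ^ (-j - 1) < |v k| ∧ |v k| ≤ (2 : ℝ) ^ (-j)

/-- The index set `J` of the binary decomposition of `v`: those `j` with `K(j) ≠ ∅`. -/
def binIdx {n : ℕ} (v : Fin n → ℝ) : Set ℤ := {j | (binClass v j).Nonempty}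

/-- The piece `v^{(j)}` of the binary decomposition of `v`: it agrees with `v` on `K(j)`
and vanishes elsewhere, so that `v = ∑_{j ∈ J} v^{(j)}`. -/
noncomputable def binComp {n : ℕ} (v : Fin n → ℝ) (j : ℤ) : Fin n → ℝ :=
  fun k => if k ∈ binClass v j then v k else 0

/-- The uniform probability measure on the interval `[-1, 1] ⊂ ℝ`. -/
noncomputable def unifInterval : Measure ℝ :=
  (2⁻¹ : ENNReal) • volume.restrict (Set.Icc (-1 : ℝ) 1)

/-- A realization of the family `α = (α_{ℓ j})_{ℓ ∈ [m], j ∈ ℤ}` from a finite array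
`ω ∈ ℝ^{m × n}`: `α_{ℓ j} := ω_{ℓ k(j)}` where `k(j)` is a fixed representative of the
dyadic class `K_ℓ(j)` of `v_ℓ` (and `α_{ℓ j} := 0` for the irrelevant indices
`j ∉ J_ℓ`). Since the classes `K_ℓ(j)`, `j ∈ J_ℓ`, are pairwise disjoint, pushing
forward a product of uniform measures on `[-1,1]` by this map makes the variables
`α_{ℓ j}`, `ℓ ∈ [m]`, `j ∈ J_ℓ`, independent and uniform on `[-1,1]`. -/
noncomputable def alphaOf {n m : ℕ} (v : Fin m → Fin n → ℝ) (ω : Fin m → Fin n → ℝ) :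
    Fin m → ℤ → ℝ :=
  fun ℓ j => if h : (binClass (v ℓ) j).Nonempty then ω ℓ ((binClass (v ℓ) j).min' h) else 0

/-- The joint distribution of the coefficients `α_{ℓ j}` in Definition 2.2: the
`α_{ℓ j}`, `ℓ ∈ [m]`, `j ∈ J_ℓ`, are independent, uniformly distributed on `[-1,1]`. -/
noncomputable def alphaMeasure (n m : ℕ) (v : Fin m → Fin n → ℝ) :
    Measure (Fin m → ℤ → ℝ) :=
  Measure.map (alphaOf v) (Measure.pi fun _ : Fin m => Measure.pi fun _ : Fin n => unifInterval)

/-- The random bias vector of Definition 2.2: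
`P(α) = (1/(10√(m log n))) ∑_{ℓ=1}^m ∑_{j ∈ J_ℓ} α_{ℓ j} 2^j v_ℓ^{(j)}`,
where `v_ℓ = ∑_{j ∈ J_ℓ} v_ℓ^{(j)}` is the binary decomposition of `v_ℓ`.
(The sum over `j` is a `finsum`: all but finitely many terms vanish, since `v_ℓ^{(j)} = 0`
for `j ∉ J_ℓ`.) -/
noncomputable def biasP (n m : ℕ) (v : Fin m → Fin n → ℝ) (a : Fin m → ℤ → ℝ) :
    Fin n → ℝ :=
  fun k => (10 * Real.sqrt (m * Real.log n))⁻¹ *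
    ∑ ℓ, ∑ᶠ j : ℤ, a ℓ j * (2 : ℝ) ^ j * binComp (v ℓ) j k

/-- The biased product measure `μ_p` on `{-1,1}^n ⊂ ℝ^n`: coordinates are independent,
with `Pr[x i = 1] = (1 + p i)/2` and `Pr[x i = -1] = (1 - p i)/2`. -/
noncomputable def cubeMeasure {n : ℕ} (p : Fin n → ℝ) : Measure (Fin n → ℝ) :=
  Measure.pi fun i =>
    ENNReal.ofReal ((1 + p i) / 2) • Measure.dirac (1 : ℝ) +
      ENNReal.ofReal ((1 - p i) / 2) • Measure.dirac (-1 : ℝ)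

/-- The joint distribution of `(P, x)`, where `P` is the random bias vector of
Definition 2.2 (parametrized by `α`), conditioned on `‖P‖_∞ ≤ 1/2`, and, given `P`,
`x ~ μ_P`. -/
noncomputable def biasJoint (n m : ℕ) (v : Fin m → Fin n → ℝ) :
    Measure ((Fin m → ℤ → ℝ) × (Fin n → ℝ)) :=
  (ProbabilityTheory.cond (alphaMeasure n m v) {a | ∀ k, |biasP n m v a k| ≤ 1 / 2}).bind
    fun a => (cubeMeasure (biasP n m v a)).map (Prod.mk a)


noncomputable def sg8 (b : Bool) : ℝ := if b then 1 else -1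

noncomputable def wt8 {n : ℕ} (p : Fin n → ℝ) (s : Fin n → Bool) : ℝ :=
  ∏ i, (1 + sg8 (s i) * p i) / 2

noncomputable def wte8 {n : ℕ} (p : Fin n → ℝ) (i : Fin n) (s : Fin n → Bool) : ℝ :=
  ∏ j ∈ Finset.univ.erase i, (1 + sg8 (s j) * p j) / 2

noncomputable def lin8 {n : ℕ} (v : Fin n → ℝ) (s : Fin n → Bool) : ℝ :=
  ∑ i, v i * sg8 (s i)

noncomputable def pr8 {n : ℕ} (p v : Fin n → ℝ) (t r : ℝ) : ℝ :=
  ∑ s : Fin n → Bool, wt8 p s * (if |lin8 v s - t| < r then 1 else 0)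

lemma sg8_cases (b : Bool) : sg8 b = 1 ∨ sg8 b = -1 := by cases b <;> simp [sg8]

lemma fac8_nonneg (b : Bool) (x : ℝ) (hx : |x| ≤ 1) : 0 ≤ (1 + sg8 b * x) / 2 := by
  have := abs_le.1 hx
  rcases sg8_cases b with h | h <;> rw [h] <;> linarith

lemma resample8 {n : ℕ} (i : Fin n) (H : (Fin n → Bool) → ℝ) :
    ∑ s, H s = (1 / 2) * ∑ s, (H (Function.update s i true) + H (Function.update s i false)) := by
  have hinv : Function.Involutive (fun s : Fin n → Bool => Function.update s i (!s i)) := by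
    intro s; simp
  have h1 : ∑ s, H (Function.update s i (!s i)) = ∑ s, H s :=
    Equiv.sum_comp hinv.toPerm H
  have h2 : ∀ s : Fin n → Bool, H (Function.update s i true) + H (Function.update s i false)
      = H s + H (Function.update s i (!s i)) := by
    intro s
    have h3 : Function.update s i (s i) = s := Function.update_eq_self i s
    cases h : s i
    · rw [h] at h3; rw [h3]; simp [add_comm]
    · rw [h] at h3; rw [h3]; simp
  simp only [h2, Finset.sum_add_distrib, h1]; ring

lemma wt8_nonneg {n : ℕ} (p : Fin n → ℝ) (hp : ∀ i, |p i| ≤ 1) (s) : 0 ≤ wt8 p s :=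
  Finset.prod_nonneg fun i _ => fac8_nonneg _ _ (hp i)

lemma wte8_nonneg {n : ℕ} (p : Fin n → ℝ) (hp : ∀ i, |p i| ≤ 1) (i) (s) : 0 ≤ wte8 p i s :=
  Finset.prod_nonneg fun i _ => fac8_nonneg _ _ (hp i)

lemma wt8_eq {n : ℕ} (p : Fin n → ℝ) (i) (s) :
    wt8 p s = wte8 p i s * ((1 + sg8 (s i) * p i) / 2) := by
  unfold wt8 wte8
  rw [Finset.prod_erase_mul _ _ (Finset.mem_univ i)]

lemma wte8_update {n : ℕ} (p : Fin n → ℝ) (i) (s) (b) :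
    wte8 p i (Function.update s i b) = wte8 p i s := by
  unfold wte8
  refine Finset.prod_congr rfl fun j hj => ?_
  rw [Function.update_of_ne (Finset.ne_of_mem_erase hj)]

lemma wt8_update {n : ℕ} (p : Fin n → ℝ) (i) (s) (b) :
    wt8 p (Function.update s i b) = wte8 p i s * ((1 + sg8 b * p i) / 2) := by
  rw [wt8_eq p i, wte8_update, Function.update_self]

lemma lin8_update {n : ℕ} (v : Fin n → ℝ) (i) (s) (b) :
    lin8 v (Function.update s i b) = lin8 (Function.update v i 0) s + v i * sg8 b := by
  unfold lin8
  rw [← Finset.sum_erase_add _ _ (Finset.mem_univ i),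
    ← Finset.sum_erase_add (f := fun j => Function.update v i 0 j * sg8 (s j)) _ (Finset.mem_univ i)]
  simp only [Function.update_self, zero_mul, add_zero]
  congr 1
  refine Finset.sum_congr rfl fun j hj => ?_
  rw [Function.update_of_ne (Finset.ne_of_mem_erase hj), Function.update_of_ne (Finset.ne_of_mem_erase hj)]

lemma lin8_update0 {n : ℕ} (v : Fin n → ℝ) (i) (s) (b) :
    lin8 (Function.update v i 0) (Function.update s i b) = lin8 (Function.update v i 0) s := by
  rw [lin8_update]; simp

lemma peel8 {n : ℕ} (p v : Fin n → ℝ) (hp : ∀ i, |p i| ≤ 1 / 2) (t r : ℝ) (i : Fin n)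
    (hr : 0 < r) (hi : r ≤ |v i|) :
    pr8 p v t r ≤ 3 / 4 * pr8 p (Function.update v i 0) t (2 * |v i|) := by
  unfold pr8
  rw [resample8 i, resample8 i (fun s => wt8 p s *
    (if |lin8 (Function.update v i 0) s - t| < 2 * |v i| then 1 else 0))]
  rw [mul_left_comm, Finset.mul_sum (a := (3 / 4 : ℝ))]
  refine mul_le_mul_of_nonneg_left (Finset.sum_le_sum fun s _ => ?_) (by norm_num)
  simp only [wt8_update, lin8_update0]
  rw [lin8_update, lin8_update]
  set y := lin8 (Function.update v i 0) s
  have hw := wte8_nonneg p (fun i => (hp i).trans (by norm_num)) i s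
  set w := wte8 p i s
  have hpi := abs_le.1 (hp i)
  have key : (1 + p i) / 2 * (if |y + v i - t| < r then 1 else 0) +
      (1 - p i) / 2 * (if |y - v i - t| < r then 1 else 0)
      ≤ 3 / 4 * (if |y - t| < 2 * |v i| then (1:ℝ) else 0) := by
    by_cases h1 : |y + v i - t| < r <;> by_cases h2 : |y - v i - t| < r <;>
      by_cases h3 : |y - t| < 2 * |v i| <;> simp only [h1, h2, h3, if_true, if_false] <;>
      first
      | linarith
      | (exfalso
         rcases abs_cases (v i) with h | h <;> grind)
  have := mul_le_mul_of_nonneg_left key hw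
  simp only [sg8, if_true, Bool.false_eq_true, if_false, mul_one, one_mul, mul_neg, neg_mul]
  simp only [← sub_eq_add_neg]
  nlinarith [this]

lemma sum_wt8 {n : ℕ} (p : Fin n → ℝ) : ∑ s : Fin n → Bool, wt8 p s = 1 := by
  unfold wt8
  have := Finset.prod_univ_sum (fun _ : Fin n => (Finset.univ : Finset Bool))
    (fun i b => (1 + sg8 b * p i) / 2)
  rw [Fintype.piFinset_univ] at this
  rw [← this]
  refine Finset.prod_eq_one fun i _ => ?_
  simp [sg8]; ring

lemma pr8_le_one {n : ℕ} (p v : Fin n → ℝ) (hp : ∀ i, |p i| ≤ 1) (t r : ℝ) :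
    pr8 p v t r ≤ 1 := by
  have h1 := sum_wt8 p
  rw [← h1]
  refine Finset.sum_le_sum fun s _ => ?_
  have := wt8_nonneg p hp s
  split_ifs <;> linarith

lemma pr8_nonneg {n : ℕ} (p v : Fin n → ℝ) (hp : ∀ i, |p i| ≤ 1) (t r : ℝ) :
    0 ≤ pr8 p v t r := by
  refine Finset.sum_nonneg fun s _ => ?_
  have := wt8_nonneg p hp s
  split_ifs <;> linarith

lemma chain8 {n : ℕ} (p : Fin n → ℝ) (hp : ∀ i, |p i| ≤ 1 / 2) (t : ℝ) (L : List (Fin n)) :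
    ∀ (v : Fin n → ℝ) (r : ℝ), 0 < r → (∀ a ∈ L, r ≤ |v a|) →
      L.Pairwise (fun a b => 2 * |v a| ≤ |v b|) → pr8 p v t r ≤ (3 / 4) ^ L.length := by
  induction L with
  | nil => intro v r _ _ _; simpa using pr8_le_one p v (fun i => (hp i).trans (by norm_num)) t r
  | cons i L ih =>
    intro v r hr h1 h2
    rw [List.pairwise_cons] at h2
    have hi : r ≤ |v i| := h1 i (by simp)
    have hne : ∀ b ∈ L, Function.update v i 0 b = v b := by
      intro b hb
      refine Function.update_of_ne ?_ _ _
      rintro rfl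
      have := h2.1 b hb
      linarith
    have := ih (Function.update v i 0) (2 * |v i|) (by linarith)
      (fun a ha => by rw [hne a ha]; exact h2.1 a ha)
      (h2.2.imp_of_mem (fun {a b} ha hb hab => by rw [hne a ha, hne b hb]; exact hab))
    have h3 := peel8 p v hp t r i hr hi
    rw [List.length_cons, pow_succ]
    linarith

noncomputable def clamp8 (t d y : ℝ) : ℝ := max (t - 4 * d) (min y (t + 4 * d))

lemma hasDeriv8 {n : ℕ} (q c : Fin n → ℝ) (F : (Fin n → Bool) → ℝ) (a : ℝ) :
    HasDerivAt (fun a => ∑ s, wt8 (fun i => q i + a * c i) s * F s)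
      (∑ i, c i / 2 * ∑ s, wte8 (fun i => q i + a * c i) i s * sg8 (s i) * F s) a := by
  have h1 : ∀ s : Fin n → Bool, HasDerivAt (fun a => wt8 (fun i => q i + a * c i) s)
      (∑ i, wte8 (fun i => q i + a * c i) i s * (sg8 (s i) * c i / 2)) a := by
    intro s
    unfold wt8 wte8
    have := HasDerivAt.fun_finsetProd (u := (Finset.univ : Finset (Fin n)))
      (f := fun i a => (1 + sg8 (s i) * (q i + a * c i)) / 2)
      (f' := fun i => sg8 (s i) * c i / 2) (x := a) (fun i _ => by
        have := ((((hasDerivAt_id a).mul_const (c i)).const_add (q i)).const_mul (sg8 (s i))).const_add 1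
        have := this.div_const 2
        simpa using this)
    simpa using this
  have h2 := HasDerivAt.fun_sum (u := Finset.univ) (fun s (_ : s ∈ Finset.univ) => (h1 s).mul_const (F s))
  refine h2.congr_deriv ?_
  symm
  simp only [Finset.mul_sum, Finset.sum_mul]
  rw [Finset.sum_comm]
  refine Finset.sum_congr rfl fun i _ => Finset.sum_congr rfl fun s _ => ?_
  ring

lemma clamp8_diff (t d y v c κ : ℝ) (hd : 0 < d) (hκ : 0 < κ) (h1 : d / 2 ≤ |v|) (h2 : |v| ≤ d)
    (h3 : κ ≤ |c|) (h4 : 0 ≤ c * v) :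
    0 ≤ c * (clamp8 t d (y + v) - clamp8 t d (y - v)) ∧
    ((|y + v - t| < 2 * d ∨ |y - v - t| < 2 * d) →
      κ * d ≤ c * (clamp8 t d (y + v) - clamp8 t d (y - v))) := by
  wlog hv : 0 ≤ v generalizing v c
  · have := this (-v) (-c) (by simpa using h1) (by simpa using h2) (by simpa using h3)
      (by linarith) (by linarith)
    simp only [sub_neg_eq_add, ← sub_eq_add_neg] at this
    refine ⟨by linarith [this.1], fun h => ?_⟩
    linarith [this.2 h.symm]
  rw [abs_of_nonneg hv] at h1 h2
  have hc : 0 ≤ c := by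
    by_contra hc
    push Not at hc
    nlinarith
  rw [abs_of_nonneg hc] at h3
  have hm : 0 ≤ clamp8 t d (y + v) - clamp8 t d (y - v) := by
    unfold clamp8; grind
  refine ⟨mul_nonneg hc hm, fun h => ?_⟩
  have hd2 : d ≤ clamp8 t d (y + v) - clamp8 t d (y - v) := by
    have e1 : clamp8 t d (y + v) = y + v := by unfold clamp8; grind
    have e2 : clamp8 t d (y - v) = y - v := by unfold clamp8; grind
    rw [e1, e2]; linarith
  nlinarith

lemma russo8 {n : ℕ} (p v c : Fin n → ℝ) (hp : ∀ i, |p i| ≤ 1) (K : Finset (Fin n))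
    (t d κ : ℝ) (hd : 0 < d) (hκ : 0 < κ)
    (h1 : ∀ i ∈ K, d / 2 ≤ |v i|) (h2 : ∀ i ∈ K, |v i| ≤ d) (h3 : ∀ i ∈ K, κ ≤ |c i|)
    (h4 : ∀ i ∈ K, 0 ≤ c i * v i) (h5 : ∀ i ∉ K, c i = 0) :
    K.card * (κ * d / 2) * pr8 p v t (2 * d) ≤
      ∑ i, c i / 2 * ∑ s, wte8 p i s * sg8 (s i) * clamp8 t d (lin8 v s) := by
  have key : ∀ i ∈ K, κ * d / 2 * pr8 p v t (2 * d) ≤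
      c i / 2 * ∑ s, wte8 p i s * sg8 (s i) * clamp8 t d (lin8 v s) := by
    intro i hi
    unfold pr8
    rw [resample8 i, resample8 i (fun s => wte8 p i s * sg8 (s i) * clamp8 t d (lin8 v s))]
    rw [mul_left_comm, mul_left_comm (c i / 2), Finset.mul_sum (a := κ * d / 2),
      Finset.mul_sum (a := c i / 2)]
    refine mul_le_mul_of_nonneg_left (Finset.sum_le_sum fun s _ => ?_) (by norm_num)
    simp only [wt8_update, wte8_update, Function.update_self, lin8_update]
    set y := lin8 (Function.update v i 0) s
    have hw := wte8_nonneg p hp i s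
    set w := wte8 p i s
    have hpi := abs_le.1 (hp i)
    simp only [sg8, if_true, Bool.false_eq_true, if_false, mul_one, one_mul, mul_neg, neg_mul]
    simp only [← sub_eq_add_neg]
    obtain ⟨k1, k2⟩ := clamp8_diff t d y (v i) (c i) κ hd hκ (h1 i hi) (h2 i hi) (h3 i hi) (h4 i hi)
    set D := clamp8 t d (y + v i) - clamp8 t d (y - v i) with hD
    have hkd : 0 < κ * d := mul_pos hκ hd
    have key : κ * d * ((1 + p i) / 2 * (if |y + v i - t| < 2 * d then 1 else 0) +
      (1 - p i) / 2 * (if |y - v i - t| < 2 * d then 1 else 0)) ≤ c i * D := by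
      by_cases h1 : |y + v i - t| < 2 * d <;> by_cases h2 : |y - v i - t| < 2 * d <;>
        simp only [h1, h2, if_true, if_false]
      · have := k2 (Or.inl h1); nlinarith
      · have := k2 (Or.inl h1); nlinarith
      · have := k2 (Or.inr h2); nlinarith
      · linarith
    have := mul_le_mul_of_nonneg_left key hw
    have e : c i / 2 * (w * clamp8 t d (y + v i) + -(w * clamp8 t d (y - v i))) = w * (c i * D) / 2 := by
      rw [hD]; ring
    rw [← sub_eq_add_neg] at e
    rw [e]
    linarith
  have e : ∑ i, c i / 2 * ∑ s, wte8 p i s * sg8 (s i) * clamp8 t d (lin8 v s)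
      = ∑ i ∈ K, c i / 2 * ∑ s, wte8 p i s * sg8 (s i) * clamp8 t d (lin8 v s) := by
    symm
    refine Finset.sum_subset (Finset.subset_univ _) fun i _ hi => ?_
    rw [h5 i hi]; simp
  rw [e, mul_assoc, ← nsmul_eq_mul]
  exact Finset.card_nsmul_le_sum _ _ _ key

lemma slice8 {n : ℕ} (q v c : Fin n → ℝ) (K : Finset (Fin n))
    (t d κ : ℝ) (hd : 0 < d) (hκ : 0 < κ)
    (h1 : ∀ i ∈ K, d / 2 ≤ |v i|) (h2 : ∀ i ∈ K, |v i| ≤ d) (h3 : ∀ i ∈ K, κ ≤ |c i|)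
    (h4 : ∀ i ∈ K, 0 ≤ c i * v i) (h5 : ∀ i ∉ K, c i = 0) :
    (K.card : ENNReal) * ∫⁻ a, (if ∀ i, |q i + a * c i| ≤ 1 / 2 then
      ENNReal.ofReal (pr8 (fun i => q i + a * c i) v t (2 * d)) else 0) ∂unifInterval ≤
      ENNReal.ofReal (8 / κ) := by
  set S : Set ℝ := {a | ∀ i, |q i + a * c i| ≤ 1 / 2} with hS
  set I : Set ℝ := Set.Icc (-1) 1 ∩ S with hI
  have hSc : IsClosed S := by
    have : S = ⋂ i, {a | |q i + a * c i| ≤ 1 / 2} := by ext; simp [hS]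
    rw [this]
    refine isClosed_iInter fun i => isClosed_le (by fun_prop) continuous_const
  have hSconv : Convex ℝ S := by
    have : S = ⋂ i, (fun a : ℝ => a * c i) ⁻¹' {x | |q i + x| ≤ 1 / 2} := by ext; simp [hS]
    rw [this]
    refine convex_iInter fun i => ?_
    have hc : Convex ℝ {x : ℝ | |q i + x| ≤ 1 / 2} := by
      have : {x : ℝ | |q i + x| ≤ 1 / 2} = Set.Icc (-(1/2) - q i) (1 / 2 - q i) := by
        ext x; simp only [Set.mem_ofPred_eq, Set.mem_Icc, abs_le]
        constructor <;> rintro ⟨h1, h2⟩ <;> constructor <;> linarith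
      rw [this]; exact convex_Icc _ _
    exact hc.is_linear_preimage (IsLinearMap.mk (fun x y => add_mul x y _) (fun x y => by simp [mul_assoc]))
  have e1 : ∫⁻ a, (if ∀ i, |q i + a * c i| ≤ 1 / 2 then
      ENNReal.ofReal (pr8 (fun i => q i + a * c i) v t (2 * d)) else 0) ∂unifInterval
      = 2⁻¹ * ∫⁻ a in I, ENNReal.ofReal (pr8 (fun i => q i + a * c i) v t (2 * d)) := by
    unfold unifInterval
    rw [lintegral_smul_measure, smul_eq_mul, hI, Set.inter_comm, ← Measure.restrict_restrict hSc.measurableSet,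
      ← lintegral_indicator hSc.measurableSet]
    congr 2
    funext a
    simp [Set.indicator_apply, hS]
  rw [e1]
  rcases Set.eq_empty_or_nonempty I with hE | hne
  · rw [hE]; simp
  have hIcc := eq_Icc_of_connected_compact (s := I)
    ⟨hne, ((convex_Icc _ _).inter hSconv).isPreconnected⟩ (isCompact_Icc.inter_right hSc)
  obtain ⟨x, y, hxy⟩ : ∃ x y, I = Set.Icc x y := ⟨_, _, hIcc⟩
  have hle : x ≤ y := by rw [hxy] at hne; exact Set.nonempty_Icc.1 hne
  set Φ : ℝ → ℝ := fun a => ∑ s, wt8 (fun i => q i + a * c i) s * clamp8 t d (lin8 v s) with hΦ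
  set Φ' : ℝ → ℝ := fun a => ∑ i, c i / 2 * ∑ s, wte8 (fun i => q i + a * c i) i s * sg8 (s i) *
    clamp8 t d (lin8 v s) with hΦ'
  have hder : ∀ a, HasDerivAt Φ (Φ' a) a := fun a => hasDeriv8 q c _ a
  have hcont : Continuous Φ' := by
    simp only [hΦ', wte8]; fun_prop
  have hSabs : ∀ a ∈ S, ∀ i, |q i + a * c i| ≤ 1 := fun a ha i => (ha i).trans (by norm_num)
  have hkd : 0 < κ * d := mul_pos hκ hd
  have hpt : ∀ a ∈ S, K.card * pr8 (fun i => q i + a * c i) v t (2 * d) ≤ 2 / (κ * d) * Φ' a := by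
    intro a ha
    have := russo8 (fun i => q i + a * c i) v c (hSabs a ha) K t d κ hd hκ h1 h2 h3 h4 h5
    rw [div_mul_eq_mul_div, le_div_iff₀ hkd]
    linarith
  have hnn : ∀ a ∈ S, 0 ≤ 2 / (κ * d) * Φ' a := fun a ha =>
    (mul_nonneg (Nat.cast_nonneg _) (pr8_nonneg _ v (hSabs a ha) t _)).trans (hpt a ha)
  have hbd : ∀ a ∈ S, t - 4 * d ≤ Φ a ∧ Φ a ≤ t + 4 * d := by
    intro a ha
    have hs := sum_wt8 (fun i => q i + a * c i)
    have hw := wt8_nonneg (fun i => q i + a * c i) (hSabs a ha)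
    constructor
    · have : ∑ s, wt8 (fun i => q i + a * c i) s * (t - 4 * d) ≤ Φ a :=
        Finset.sum_le_sum fun s _ => mul_le_mul_of_nonneg_left
          (by unfold clamp8; exact le_max_left _ _) (hw s)
      rwa [← Finset.sum_mul, hs, one_mul] at this
    · have : Φ a ≤ ∑ s, wt8 (fun i => q i + a * c i) s * (t + 4 * d) :=
        Finset.sum_le_sum fun s _ => mul_le_mul_of_nonneg_left
          (by unfold clamp8; exact max_le (by linarith) (min_le_right _ _)) (hw s)
      rwa [← Finset.sum_mul, hs, one_mul] at this
  have hIS : I ⊆ S := Set.inter_subset_right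
  have hmI : MeasurableSet I := by rw [hxy]; exact measurableSet_Icc
  have main : (K.card : ENNReal) * ∫⁻ a in I, ENNReal.ofReal (pr8 (fun i => q i + a * c i) v t (2 * d))
      ≤ ENNReal.ofReal (16 / κ) := by
    rw [← lintegral_const_mul' _ _ (ENNReal.natCast_ne_top _)]
    calc ∫⁻ a in I, (K.card : ENNReal) * ENNReal.ofReal (pr8 (fun i => q i + a * c i) v t (2 * d))
        ≤ ∫⁻ a in I, ENNReal.ofReal (2 / (κ * d) * Φ' a) := by
          refine setLIntegral_mono' hmI fun a ha => ?_
          rw [← ENNReal.ofReal_natCast, ← ENNReal.ofReal_mul (Nat.cast_nonneg _)]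
          exact ENNReal.ofReal_le_ofReal (hpt a (hIS ha))
      _ = ENNReal.ofReal (∫ a in I, 2 / (κ * d) * Φ' a) := by
          rw [ofReal_integral_eq_lintegral_ofReal]
          · rw [hxy]; exact (continuous_const.mul hcont).integrableOn_Icc
          · exact (ae_restrict_iff' hmI).2 (Filter.Eventually.of_forall fun a ha => hnn a (hIS ha))
      _ ≤ ENNReal.ofReal (16 / κ) := by
          refine ENNReal.ofReal_le_ofReal ?_
          rw [hxy, integral_Icc_eq_integral_Ioc, ← intervalIntegral.integral_of_le hle,
            intervalIntegral.integral_const_mul,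
            intervalIntegral.integral_eq_sub_of_hasDerivAt (fun a _ => hder a)
              (hcont.intervalIntegrable _ _)]
          have hx := hbd x (hIS (by rw [hxy]; exact Set.left_mem_Icc.2 hle))
          have hy := hbd y (hIS (by rw [hxy]; exact Set.right_mem_Icc.2 hle))
          rw [div_mul_eq_mul_div, div_le_div_iff₀ hkd hκ]
          have : Φ y - Φ x ≤ 8 * d := by linarith [hx.1, hy.2]
          nlinarith
  calc (K.card : ENNReal) * (2⁻¹ * ∫⁻ a in I, ENNReal.ofReal (pr8 (fun i => q i + a * c i) v t (2 * d)))
      = 2⁻¹ * ((K.card : ENNReal) * ∫⁻ a in I, ENNReal.ofReal (pr8 (fun i => q i + a * c i) v t (2 * d))) := by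
        ring
    _ ≤ 2⁻¹ * ENNReal.ofReal (16 / κ) := by gcongr
    _ = ENNReal.ofReal (8 / κ) := by
        rw [show (2⁻¹ : ENNReal) = ENNReal.ofReal 2⁻¹ by
          rw [ENNReal.ofReal_inv_of_pos (by norm_num)]; simp, ← ENNReal.ofReal_mul (by norm_num)]
        congr 1; ring

instance unif8_prob : IsProbabilityMeasure unifInterval := by
  constructor
  unfold unifInterval
  simp only [Measure.smul_apply, MeasurableSet.univ, Measure.restrict_apply, Set.univ_inter,
    Real.volume_Icc, smul_eq_mul]
  rw [show (1 : ℝ) - -1 = 2 by norm_num]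
  simp [ENNReal.inv_mul_cancel]

lemma pi_slice8 {ι : Type*} [Fintype ι] [DecidableEq ι] {X : ι → Type*} [∀ i, MeasurableSpace (X i)]
    (μ : ∀ i, Measure (X i)) [∀ i, IsProbabilityMeasure (μ i)] (i : ι)
    (f : (∀ i, X i) → ENNReal) (hf : Measurable f) (D : ENNReal)
    (h : ∀ x, ∫⁻ y, f (Function.update x i y) ∂μ i ≤ D) :
    ∫⁻ x, f x ∂Measure.pi μ ≤ D := by
  have := lintegral_le_of_lmarginal_le (μ := μ) {i} (f := f) (g := fun _ => D) hf measurable_const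
    (fun x => by rw [lmarginal_singleton, lmarginal_singleton]; simpa using h x)
  simpa using this

lemma cube8 {n : ℕ} (p : Fin n → ℝ) (hp : ∀ i, |p i| ≤ 1) :
    cubeMeasure p = ∑ s : Fin n → Bool, ENNReal.ofReal (wt8 p s) •
      Measure.dirac (fun i => sg8 (s i)) := by
  unfold cubeMeasure
  have (i : Fin n) : IsFiniteMeasure (ENNReal.ofReal ((1 + p i) / 2) • Measure.dirac (1 : ℝ) +
      ENNReal.ofReal ((1 - p i) / 2) • Measure.dirac (-1 : ℝ)) := by
    constructor
    simp
  refine Measure.pi_eq fun B hB => ?_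
  rw [Measure.finsetSum_apply]
  have h1 : ∀ s : Fin n → Bool, (ENNReal.ofReal (wt8 p s) •
      Measure.dirac (fun i => sg8 (s i))) (Set.univ.pi B) =
      ∏ i, (ENNReal.ofReal ((1 + sg8 (s i) * p i) / 2) * (B i).indicator 1 (sg8 (s i))) := by
    intro s
    rw [Measure.smul_apply, Measure.dirac_apply' _ (MeasurableSet.univ_pi hB), Finset.prod_mul_distrib,
      smul_eq_mul]
    unfold wt8
    rw [ENNReal.ofReal_prod_of_nonneg (fun i _ => fac8_nonneg _ _ (hp i))]
    congr 1
    by_cases h : ∀ i, sg8 (s i) ∈ B i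
    · rw [Set.indicator_of_mem (by simpa using h)]
      rw [Finset.prod_eq_one]
      · rfl
      · intro i _; rw [Set.indicator_of_mem (h i)]; rfl
    · rw [Set.indicator_of_notMem (by simpa using h)]
      push Not at h
      obtain ⟨i, hi⟩ := h
      rw [Finset.prod_eq_zero (Finset.mem_univ i)]
      rw [Set.indicator_of_notMem hi]
  simp only [h1]
  have := Finset.prod_univ_sum (fun _ : Fin n => (Finset.univ : Finset Bool))
    (fun i b => ENNReal.ofReal ((1 + sg8 b * p i) / 2) * (B i).indicator 1 (sg8 b))
  rw [Fintype.piFinset_univ] at this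
  rw [← this]
  refine Finset.prod_congr rfl fun i _ => ?_
  rw [Measure.add_apply, Measure.smul_apply, Measure.smul_apply, Measure.dirac_apply' _ (hB i),
    Measure.dirac_apply' _ (hB i)]
  simp [sg8, sub_eq_add_neg]

lemma cube8_apply {n : ℕ} (p v : Fin n → ℝ) (hp : ∀ i, |p i| ≤ 1) (t r : ℝ) :
    cubeMeasure p {x | |(∑ i, v i * x i) - t| < r} = ENNReal.ofReal (pr8 p v t r) := by
  have hm : MeasurableSet {x : Fin n → ℝ | |(∑ i, v i * x i) - t| < r} :=
    measurableSet_lt (by fun_prop) measurable_const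
  rw [cube8 p hp, Measure.finsetSum_apply]
  unfold pr8
  rw [ENNReal.ofReal_sum_of_nonneg]
  · refine Finset.sum_congr rfl fun s _ => ?_
    rw [Measure.smul_apply, Measure.dirac_apply' _ hm, ENNReal.ofReal_mul (wt8_nonneg p hp s), smul_eq_mul]
    congr 1
    by_cases h : |lin8 v s - t| < r
    · rw [if_pos h, Set.indicator_of_mem (by exact h)]; simp
    · rw [if_neg h, Set.indicator_of_notMem (by exact h)]; simp
  · intro s _
    have := wt8_nonneg p hp s
    split_ifs <;> simp [this]

lemma class8_unique {n : ℕ} (v : Fin n → ℝ) (k : Fin n) (j j' : ℤ) (h : k ∈ binClass v j)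
    (h' : k ∈ binClass v j') : j = j' := by
  have aux : ∀ a b : ℤ, k ∈ binClass v a → k ∈ binClass v b → ¬ a < b := by
    intro a b ha hb hab
    simp only [binClass, Finset.mem_filter, Finset.mem_univ, true_and] at ha hb
    have : (2 : ℝ) ^ (-b) ≤ 2 ^ (-a - 1) := zpow_le_zpow_right₀ (by norm_num) (by omega)
    linarith [ha.1, hb.2]
  exact le_antisymm (not_lt.1 (aux _ _ h' h)) (not_lt.1 (aux _ _ h h'))

lemma class8_exists {n : ℕ} (v : Fin n → ℝ) (k : Fin n) (h : v k ≠ 0) :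
    ∃ j, k ∈ binClass v j := by
  obtain ⟨a, ha⟩ := exists_mem_Ioc_zpow (abs_pos.2 h) (one_lt_two : (1 : ℝ) < 2)
  refine ⟨-a - 1, ?_⟩
  simp only [binClass, Finset.mem_filter, Finset.mem_univ, true_and]
  rw [show - (-a - 1) - 1 = a by ring, show -(-a - 1) = a + 1 by ring]
  exact ha

lemma class8_ne {n : ℕ} (v : Fin n → ℝ) (k : Fin n) (j : ℤ) (h : k ∈ binClass v j) : v k ≠ 0 := by
  simp only [binClass, Finset.mem_filter, Finset.mem_univ, true_and] at h
  have : (0 : ℝ) < 2 ^ (-j - 1) := by positivity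
  rw [← abs_pos]; linarith [h.1]

lemma term8_zero {n : ℕ} (v : Fin n → ℝ) (k : Fin n) (h : v k = 0) (b : ℤ → ℝ) :
    ∑ᶠ j : ℤ, b j * (2 : ℝ) ^ j * binComp v j k = 0 := by
  have : ∀ j, b j * (2 : ℝ) ^ j * binComp v j k = 0 := by
    intro j; simp [binComp, h]
  simp [this]

lemma term8 {n : ℕ} (v : Fin n → ℝ) (k : Fin n) (j : ℤ) (h : k ∈ binClass v j) (b : ℤ → ℝ) :
    ∑ᶠ j : ℤ, b j * (2 : ℝ) ^ j * binComp v j k = b j * (2 ^ j * v k) := by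
  rw [finsum_eq_single _ j]
  · simp [binComp, h, mul_assoc]
  · intro j' hj'
    have : k ∉ binClass v j' := fun h' => hj' (class8_unique v k _ _ h' h)
    simp [binComp, this]

lemma struct8 {n m : ℕ} (v : Fin m → Fin n → ℝ) (ℓ : Fin m) (k : Fin n) :
    ∃ (r : Fin n) (g : ℝ), |g| ≤ 1 ∧
      (∀ ω, ∑ᶠ j : ℤ, alphaOf v ω ℓ j * (2 : ℝ) ^ j * binComp (v ℓ) j k = ω ℓ r * g) ∧
      (∀ j (h : (binClass (v ℓ) j).Nonempty), k ∈ binClass (v ℓ) j →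
        r = (binClass (v ℓ) j).min' h ∧ g = 2 ^ j * v ℓ k ∧ 1 / 2 ≤ |g|) ∧
      (v ℓ k = 0 → g = 0) ∧ (∀ j, r ∈ binClass (v ℓ) j → k ∉ binClass (v ℓ) j → g = 0) := by
  by_cases h0 : v ℓ k = 0
  · refine ⟨k, 0, by simp, fun ω => ?_, fun j _ hj => absurd h0 (class8_ne _ _ _ hj), fun _ => rfl,
      fun _ _ _ => rfl⟩
    rw [term8_zero _ _ h0]; simp
  · obtain ⟨j, hj⟩ := class8_exists (v ℓ) k h0
    have hne : (binClass (v ℓ) j).Nonempty := ⟨k, hj⟩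
    have hp : (0 : ℝ) < 2 ^ j := by positivity
    have habs : |2 ^ j * v ℓ k| = 2 ^ j * |v ℓ k| := by rw [abs_mul, abs_of_pos hp]
    have hj2 := hj
    simp only [binClass, Finset.mem_filter, Finset.mem_univ, true_and] at hj2
    have e1 : (2 : ℝ) ^ j * 2 ^ (-j) = 1 := by rw [← zpow_add₀ (by norm_num)]; simp
    have e2 : (2 : ℝ) ^ (-j - 1) = 2 ^ (-j) / 2 := by rw [zpow_sub₀ (by norm_num)]; simp
    rw [e2] at hj2
    refine ⟨(binClass (v ℓ) j).min' hne, 2 ^ j * v ℓ k, ?_, ?_, ?_, ?_, ?_⟩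
    · rw [habs]; nlinarith
    · intro ω
      rw [term8 _ _ j hj]
      simp [alphaOf, hne]
    · intro j' hne' hj'
      have := class8_unique _ _ _ _ hj hj'
      subst this
      refine ⟨rfl, rfl, ?_⟩
      rw [habs]; nlinarith
    · intro h; exact absurd h h0
    · intro j' h1 h2
      have := class8_unique _ _ _ _ h1 ((binClass (v ℓ) j).min'_mem hne)
      subst this
      exact absurd hj h2

lemma meas_alpha8 {n m : ℕ} (v : Fin m → Fin n → ℝ) : Measurable (alphaOf v) := by
  refine measurable_pi_lambda _ fun ℓ => measurable_pi_lambda _ fun j => ?_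
  unfold alphaOf
  split_ifs with h
  · fun_prop
  · fun_prop

lemma meas_bias8 {n m : ℕ} (v : Fin m → Fin n → ℝ) : Measurable (biasP n m v) := by
  refine measurable_pi_lambda _ fun k => ?_
  unfold biasP
  refine Measurable.const_mul (Finset.measurable_sum _ fun ℓ _ => ?_) _
  by_cases h0 : v ℓ k = 0
  · simp only [term8_zero _ _ h0]; fun_prop
  · obtain ⟨j, hj⟩ := class8_exists (v ℓ) k h0
    simp only [term8 _ _ j hj]; fun_prop

lemma unif8_mean : ∫ x, x ∂unifInterval = 0 := by
  unfold unifInterval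
  rw [integral_smul_measure, integral_Icc_eq_integral_Ioc, ← intervalIntegral.integral_of_le (by norm_num)]
  simp

lemma unif8_ae : ∀ᵐ x ∂unifInterval, x ∈ Set.Icc (-1 : ℝ) 1 := by
  unfold unifInterval
  refine Measure.ae_smul_measure ?_ _
  exact ae_restrict_mem measurableSet_Icc

noncomputable abbrev base8 (n m : ℕ) : Measure (Fin m → Fin n → ℝ) :=
  Measure.pi fun _ : Fin m => Measure.pi fun _ : Fin n => unifInterval

lemma hoeff8 {n m : ℕ} (r : Fin m → Fin n) (g : Fin m → ℝ) (hg : ∀ ℓ, |g ℓ| ≤ 1)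
    (ε : ℝ) (hε : 0 ≤ ε) :
    (base8 n m).real {ω | ε ≤ ∑ ℓ, ω ℓ (r ℓ) * g ℓ} ≤ Real.exp (-ε ^ 2 / (2 * m)) := by
  have hmean : ∀ ℓ, ∫ y, y (r ℓ) * g ℓ ∂(Measure.pi fun _ : Fin n => unifInterval) = 0 := by
    intro ℓ
    rw [integral_mul_const]
    rw [integral_comp_eval (μ := fun _ : Fin n => unifInterval) (i := r ℓ) (f := fun x : ℝ => x)
      aestronglyMeasurable_id, unif8_mean, zero_mul]
  have hind : ProbabilityTheory.iIndepFun (fun ℓ (ω : Fin m → Fin n → ℝ) => ω ℓ (r ℓ) * g ℓ) (base8 n m) :=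
    ProbabilityTheory.iIndepFun_pi (μ := fun _ : Fin m => Measure.pi fun _ : Fin n => unifInterval)
      (X := fun ℓ y => y (r ℓ) * g ℓ) (fun ℓ => Measurable.aemeasurable (by fun_prop))
  have hsub : ∀ ℓ ∈ Finset.univ, ProbabilityTheory.HasSubgaussianMGF
      (fun (ω : Fin m → Fin n → ℝ) => ω ℓ (r ℓ) * g ℓ) 1 (base8 n m) := by
    intro ℓ _
    have h := ProbabilityTheory.hasSubgaussianMGF_of_mem_Icc_of_integral_eq_zero (μ := base8 n m)
      (X := fun (ω : Fin m → Fin n → ℝ) => ω ℓ (r ℓ) * g ℓ) (a := -1) (b := 1) (Measurable.aemeasurable (by fun_prop)) ?_ ?_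
    · convert h using 1
      rw [show (1 : ℝ) - -1 = 2 by norm_num]
      ext; simp
    · have q1 : Measure.QuasiMeasurePreserving (fun ω : Fin m → Fin n → ℝ => ω ℓ) (base8 n m)
        (Measure.pi fun _ : Fin n => unifInterval) :=
        (measurePreserving_eval (fun _ : Fin m => Measure.pi fun _ : Fin n => unifInterval) ℓ).quasiMeasurePreserving
      have q2 : Measure.QuasiMeasurePreserving (fun y : Fin n → ℝ => y (r ℓ))
        (Measure.pi fun _ : Fin n => unifInterval) unifInterval :=
        (measurePreserving_eval (fun _ : Fin n => unifInterval) (r ℓ)).quasiMeasurePreserving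
      filter_upwards [(q2.comp q1).ae unif8_ae] with ω hω
      have h1 : |ω ℓ (r ℓ)| ≤ 1 := abs_le.2 hω
      have : |ω ℓ (r ℓ) * g ℓ| ≤ 1 := by
        rw [abs_mul]; exact mul_le_one₀ h1 (abs_nonneg _) (hg ℓ)
      exact abs_le.1 this
    · rw [← hmean ℓ]
      exact integral_comp_eval (μ := fun _ : Fin m => Measure.pi fun _ : Fin n => unifInterval) (i := ℓ)
        (f := fun y : Fin n → ℝ => y (r ℓ) * g ℓ)
        (Measurable.aestronglyMeasurable (by fun_prop))
  have := ProbabilityTheory.HasSubgaussianMGF.measure_sum_ge_le_of_iIndepFun hind hsub hε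
  simpa using this

noncomputable def bigP8 {n m : ℕ} (v : Fin m → Fin n → ℝ) (ω : Fin m → Fin n → ℝ) : Fin n → ℝ :=
  biasP n m v (alphaOf v ω)

noncomputable def Q8 {n m : ℕ} (v : Fin m → Fin n → ℝ) (u : Fin n → ℝ) (t r : ℝ) : ENNReal :=
  ∫⁻ ω, (if ∀ i, |bigP8 v ω i| ≤ 1 / 2 then ENNReal.ofReal (pr8 (bigP8 v ω) u t r) else 0) ∂base8 n m

lemma bigP8_eq {n m : ℕ} (v : Fin m → Fin n → ℝ) (r : Fin m → Fin n → Fin n) (g : Fin m → Fin n → ℝ)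
    (h : ∀ ℓ k ω, ∑ᶠ j : ℤ, alphaOf v ω ℓ j * (2 : ℝ) ^ j * binComp (v ℓ) j k = ω ℓ (r ℓ k) * g ℓ k)
    (ω k) : bigP8 v ω k = (10 * Real.sqrt (m * Real.log n))⁻¹ * ∑ ℓ, ω ℓ (r ℓ k) * g ℓ k := by
  unfold bigP8 biasP
  simp only [h]

lemma good8 {n m : ℕ} (hn : 2 ≤ n) (hm : 2 ≤ m) (v : Fin m → Fin n → ℝ) :
    (1 / 2 : ℝ) ≤ (base8 n m).real {ω | ∀ k, |bigP8 v ω k| ≤ 1 / 2} := by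
  have hs := fun ℓ k => struct8 v ℓ k
  choose r g hg1 hg2 hg3 hg4 hg5 using hs
  have hP := bigP8_eq v r g hg2
  have hn' : (2 : ℝ) ≤ n := by exact_mod_cast hn
  have hm' : (2 : ℝ) ≤ m := by exact_mod_cast hm
  have hL : 0 < Real.log n := Real.log_pos (by linarith)
  set L := Real.log n with hLd
  have hmL : 0 < m * L := by positivity
  have hsq : 0 < Real.sqrt (m * L) := Real.sqrt_pos.2 hmL
  set ε := 5 * Real.sqrt (m * L) with hε
  have hmeas : MeasurableSet {ω | ∀ k, |bigP8 v ω k| ≤ 1 / 2} := by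
    have hb : Measurable (bigP8 v) := (meas_bias8 v).comp (meas_alpha8 v)
    have : {ω | ∀ k, |bigP8 v ω k| ≤ 1 / 2} = ⋂ k, {ω | |bigP8 v ω k| ≤ 1 / 2} := by ext; simp
    rw [this]
    exact MeasurableSet.iInter fun k => measurableSet_le (by fun_prop) measurable_const
  have hexp : Real.exp (-ε ^ 2 / (2 * m)) ≤ 1 / n ^ 3 := by
    have : -ε ^ 2 / (2 * m) ≤ -(3 * L) := by
      rw [div_le_iff₀ (by positivity), hε, mul_pow, Real.sq_sqrt hmL.le]
      nlinarith
    refine (Real.exp_le_exp.2 this).trans ?_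
    rw [Real.exp_neg, show 3 * L = ((3 : ℕ) : ℝ) * L by norm_num, Real.exp_nat_mul, hLd,
      Real.exp_log (by linarith), one_div]
  have hbad : (base8 n m).real {ω | ∀ k, |bigP8 v ω k| ≤ 1 / 2}ᶜ ≤ 1 / 2 := by
    calc (base8 n m).real {ω | ∀ k, |bigP8 v ω k| ≤ 1 / 2}ᶜ
        ≤ (base8 n m).real (⋃ k, ({ω | ε ≤ ∑ ℓ, ω ℓ (r ℓ k) * g ℓ k} ∪
            {ω | ε ≤ ∑ ℓ, ω ℓ (r ℓ k) * -g ℓ k})) := by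
          refine measureReal_mono ?_
          intro ω hω
          simp only [Set.mem_compl_iff, Set.mem_ofPred_eq, not_forall, not_le] at hω
          obtain ⟨k, hk⟩ := hω
          simp only [Set.mem_iUnion, Set.mem_union, Set.mem_ofPred_eq]
          refine ⟨k, ?_⟩
          rw [hP, abs_mul, abs_of_pos (by positivity), inv_mul_eq_div, lt_div_iff₀ (by positivity)] at hk
          simp only [mul_neg, Finset.sum_neg_distrib]
          rcases le_total 0 (∑ ℓ, ω ℓ (r ℓ k) * g ℓ k) with h | h
          · left; rw [abs_of_nonneg h] at hk; linarith
          · right; rw [abs_of_nonpos h] at hk; linarith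
      _ ≤ ∑ k, (base8 n m).real (({ω | ε ≤ ∑ ℓ, ω ℓ (r ℓ k) * g ℓ k} ∪
            {ω | ε ≤ ∑ ℓ, ω ℓ (r ℓ k) * -g ℓ k})) := measureReal_iUnion_fintype_le _
      _ ≤ ∑ k : Fin n, (1 / n ^ 3 + 1 / n ^ 3 : ℝ) := by
          refine Finset.sum_le_sum fun k _ => (measureReal_union_le _ _).trans (add_le_add ?_ ?_)
          · exact (hoeff8 _ _ (fun ℓ => hg1 ℓ k) ε (by positivity)).trans hexp
          · exact (hoeff8 _ (fun ℓ => -g ℓ k) (fun ℓ => by rw [abs_neg]; exact hg1 ℓ k) ε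
              (by positivity)).trans hexp
      _ ≤ 1 / 2 := by
          simp only [Finset.sum_const, Finset.card_univ, Fintype.card_fin, nsmul_eq_mul]
          have : (n : ℝ) * (1 / n ^ 3 + 1 / n ^ 3) = 2 / n ^ 2 := by field_simp; norm_num
          rw [this, div_le_div_iff₀ (by positivity) (by norm_num)]
          nlinarith
  have := probReal_add_probReal_compl (μ := base8 n m) hmeas
  linarith

lemma joint8_le {n m : ℕ} (hn : 2 ≤ n) (hm : 2 ≤ m) (v : Fin m → Fin n → ℝ) (u : Fin n → ℝ) (t r : ℝ) :
    biasJoint n m v {q | |(∑ i, u i * q.2 i) - t| < r} ≤ 2 * Q8 v u t r := by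
  have hS : MeasurableSet {q : (Fin m → ℤ → ℝ) × (Fin n → ℝ) | |(∑ i, u i * q.2 i) - t| < r} :=
    measurableSet_lt (by fun_prop) measurable_const
  have hb := meas_bias8 v
  set A : Set (Fin m → ℤ → ℝ) := {a | ∀ k, |biasP n m v a k| ≤ 1 / 2} with hA
  have hAm : MeasurableSet A := by
    have : A = ⋂ k, {a | |biasP n m v a k| ≤ 1 / 2} := by ext; simp [hA]
    rw [this]
    exact MeasurableSet.iInter fun k => measurableSet_le (by fun_prop) measurable_const
  have hμA : (2⁻¹ : ENNReal) ≤ alphaMeasure n m v A := by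
    unfold alphaMeasure
    rw [Measure.map_apply (meas_alpha8 v) hAm]
    have := good8 hn hm v
    have h2 := ENNReal.ofReal_le_ofReal this
    rw [ofReal_measureReal] at h2
    refine le_trans (le_of_eq ?_) h2
    rw [one_div, ENNReal.ofReal_inv_of_pos (by norm_num)]; simp
  have hinv : (alphaMeasure n m v A)⁻¹ ≤ 2 := by
    rw [ENNReal.inv_le_iff_inv_le]; exact hμA
  unfold biasJoint
  refine (Measure.bind_apply_le _ hS).trans ?_
  have e1 : ∀ a, ((cubeMeasure (biasP n m v a)).map (Prod.mk a))
      {q : (Fin m → ℤ → ℝ) × (Fin n → ℝ) | |(∑ i, u i * q.2 i) - t| < r} =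
      cubeMeasure (biasP n m v a) {x | |(∑ i, u i * x i) - t| < r} := by
    intro a
    rw [Measure.map_apply measurable_prodMk_left hS]
    rfl
  simp only [e1]
  rw [← hA]
  unfold ProbabilityTheory.cond
  rw [lintegral_smul_measure, smul_eq_mul]
  refine mul_le_mul' hinv ?_
  rw [← lintegral_indicator hAm]
  have e2 : ∀ a, A.indicator (fun a => cubeMeasure (biasP n m v a) {x | |(∑ i, u i * x i) - t| < r}) a
      = if ∀ i, |biasP n m v a i| ≤ 1 / 2 then ENNReal.ofReal (pr8 (biasP n m v a) u t r) else 0 := by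
    intro a
    by_cases h : ∀ i, |biasP n m v a i| ≤ 1 / 2
    · rw [if_pos h, Set.indicator_of_mem (by exact h), cube8_apply _ _ (fun i => (h i).trans (by norm_num))]
    · rw [if_neg h, Set.indicator_of_notMem (by exact h)]
  simp only [e2]
  exact lintegral_map_le _ _

lemma Q8_le {n m : ℕ} (v : Fin m → Fin n → ℝ) (u : Fin n → ℝ) (t r : ℝ) (ε : ℝ)
    (h : ∀ p : Fin n → ℝ, (∀ i, |p i| ≤ 1 / 2) → pr8 p u t r ≤ ε) : Q8 v u t r ≤ ENNReal.ofReal ε := by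
  unfold Q8
  calc _ ≤ ∫⁻ _, ENNReal.ofReal ε ∂base8 n m := by
        refine lintegral_mono fun ω => ?_
        dsimp only
        split_ifs with hh
        · exact ENNReal.ofReal_le_ofReal (h _ hh)
        · exact zero_le
    _ = _ := by simp

lemma Q8_mono {n m : ℕ} (v : Fin m → Fin n → ℝ) (u : Fin n → ℝ) (t r r' : ℝ) (hr : r ≤ r') :
    Q8 v u t r ≤ Q8 v u t r' := by
  unfold Q8
  refine lintegral_mono fun ω => ?_
  dsimp only
  by_cases hh : ∀ i, |bigP8 v ω i| ≤ 1 / 2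
  · rw [if_pos hh, if_pos hh]
    refine ENNReal.ofReal_le_ofReal (Finset.sum_le_sum fun s _ => mul_le_mul_of_nonneg_left ?_
      (wt8_nonneg _ (fun i => (hh i).trans (by norm_num)) s))
    split_ifs <;> linarith
  · rw [if_neg hh, if_neg hh]

lemma early8 {n m : ℕ} (hn : 2 ≤ n) (hm : 2 ≤ m) (v : Fin m → Fin n → ℝ) (z : Fin m) (t : ℝ) (j : ℤ)
    (hj : (binClass (v z) j).Nonempty) :
    ((binClass (v z) j).card : ENNReal) * Q8 v (v z) t (2 * 2 ^ (-j)) ≤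
      ENNReal.ofReal (160 * Real.sqrt (m * Real.log n)) := by
  have hs := fun ℓ k => struct8 v ℓ k
  choose r g hg1 hg2 hg3 hg4 hg5 using hs
  have hP := bigP8_eq v r g hg2
  have hn' : (2 : ℝ) ≤ n := by exact_mod_cast hn
  have hm' : (2 : ℝ) ≤ m := by exact_mod_cast hm
  have hL : 0 < Real.log n := Real.log_pos (by linarith)
  have hmL : 0 < m * Real.log n := by positivity
  have hsq : 0 < Real.sqrt (m * Real.log n) := Real.sqrt_pos.2 hmL
  set c0 := (10 * Real.sqrt (m * Real.log n))⁻¹ with hc0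
  have hc0p : 0 < c0 := by positivity
  set K := binClass (v z) j with hK
  set ρ := K.min' hj with hρ
  have hρK : ρ ∈ K := K.min'_mem hj
  have hbm : Measurable (bigP8 v) := (meas_bias8 v).comp (meas_alpha8 v)
  unfold Q8
  rw [← lintegral_const_mul' _ _ (ENNReal.natCast_ne_top _)]
  set f : (Fin m → Fin n → ℝ) → ENNReal := fun ω => (K.card : ENNReal) *
    (if ∀ i, |bigP8 v ω i| ≤ 1 / 2 then ENNReal.ofReal (pr8 (bigP8 v ω) (v z) t (2 * 2 ^ (-j))) else 0) with hf
  have hfm : Measurable f := by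
    refine Measurable.const_mul (Measurable.ite ?_ ?_ measurable_const) _
    · have : {ω | ∀ k, |bigP8 v ω k| ≤ 1 / 2} = ⋂ k, {ω | |bigP8 v ω k| ≤ 1 / 2} := by ext; simp
      rw [this]
      exact MeasurableSet.iInter fun k => measurableSet_le (by fun_prop) measurable_const
    · refine ENNReal.measurable_ofReal.comp ?_
      unfold pr8 wt8
      fun_prop
  refine pi_slice8 (fun _ : Fin m => Measure.pi fun _ : Fin n => unifInterval) z f hfm _ fun ω => ?_
  refine pi_slice8 (fun _ : Fin n => unifInterval) ρ (fun y => f (Function.update ω z y))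
    (hfm.comp (measurable_update ω)) _ fun y => ?_
  set q : Fin n → ℝ := bigP8 v (Function.update ω z (Function.update y ρ 0)) with hq
  set c : Fin n → ℝ := fun k => if k ∈ K then c0 * g z k else 0 with hc
  have hlin : ∀ a, bigP8 v (Function.update ω z (Function.update y ρ a)) = fun i => q i + a * c i := by
    intro a
    funext k
    rw [hq, hP, hP, ← Finset.sum_erase_add _ _ (Finset.mem_univ z),
      ← Finset.sum_erase_add (f := fun ℓ => Function.update ω z (Function.update y ρ 0) ℓ (r ℓ k) * g ℓ k)
        _ (Finset.mem_univ z)]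
    have e : ∀ b : ℝ, ∑ ℓ ∈ Finset.univ.erase z, Function.update ω z (Function.update y ρ b) ℓ (r ℓ k) * g ℓ k
        = ∑ ℓ ∈ Finset.univ.erase z, ω ℓ (r ℓ k) * g ℓ k := fun b =>
      Finset.sum_congr rfl fun ℓ hℓ => by rw [Function.update_of_ne (Finset.ne_of_mem_erase hℓ)]
    rw [e, e]
    simp only [Function.update_self, hc]
    by_cases hk : k ∈ K
    · have := (hg3 z k j hj hk).1
      rw [if_pos hk, this]
      simp only [← hK, ← hρ, Function.update_self]
      ring
    · rw [if_neg hk]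
      by_cases hr : r z k = ρ
      · have := hg5 z k j (by rw [hr]; exact hρK) hk
        rw [this]; ring
      · rw [Function.update_of_ne hr, Function.update_of_ne hr]; ring
  simp only [hf, hlin]
  rw [lintegral_const_mul' _ _ (ENNReal.natCast_ne_top _)]
  have hd : (0 : ℝ) < 2 ^ (-j) := by positivity
  have hmem : ∀ k ∈ K, (2 : ℝ) ^ (-j) / 2 ≤ |v z k| ∧ |v z k| ≤ 2 ^ (-j) := by
    intro k hk
    simp only [hK, binClass, Finset.mem_filter, Finset.mem_univ, true_and] at hk
    rw [zpow_sub₀ (by norm_num)] at hk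
    refine ⟨by simpa using hk.1.le, hk.2⟩
  have := slice8 q (v z) c K t (2 ^ (-j)) (c0 / 2) hd (by positivity) (fun k hk => (hmem k hk).1)
    (fun k hk => (hmem k hk).2) (fun k hk => by
      simp only [hc, if_pos hk]
      rw [abs_mul, abs_of_pos hc0p]
      nlinarith [(hg3 z k j hj hk).2.2]) (fun k hk => by
      simp only [hc, if_pos hk]
      rw [(hg3 z k j hj hk).2.1]
      have : (0 : ℝ) < 2 ^ j := by positivity
      nlinarith [mul_nonneg (mul_nonneg hc0p.le this.le) (mul_self_nonneg (v z k))]) (fun k hk => by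
      simp only [hc, if_neg hk])
  refine this.trans (le_of_eq ?_)
  congr 1
  rw [hc0]; field_simp; norm_num

lemma late8 {n : ℕ} (u p : Fin n → ℝ) (hp : ∀ i, |p i| ≤ 1 / 2) (t : ℝ) (j : ℤ) (k : Fin n)
    (hk : k ∈ binClass u j) (A : Finset ℤ) (hA : ∀ a ∈ A, (binClass u a).Nonempty ∧ a < j ∧ a % 2 = j % 2) :
    pr8 p u t (2 * |u k|) ≤ (3 / 4) ^ A.card := by
  have hk0 := abs_pos.2 (class8_ne u k j hk)
  have hrep : ∀ a : ℤ, ∃ i : Fin n, a ∈ A → i ∈ binClass u a := by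
    intro a
    by_cases ha : a ∈ A
    · obtain ⟨i, hi⟩ := (hA a ha).1
      exact ⟨i, fun _ => hi⟩
    · exact ⟨k, fun h => absurd h ha⟩
  choose ρ hρ using hrep
  have key : ∀ a b : ℤ, ∀ i i', i ∈ binClass u a → i' ∈ binClass u b → b < a → b % 2 = a % 2 →
      2 * |u i| ≤ |u i'| := by
    intro a b i i' hi hi' hab hpar
    simp only [binClass, Finset.mem_filter, Finset.mem_univ, true_and] at hi hi'
    have : (2 : ℝ) ^ (-a + 1) ≤ 2 ^ (-b - 1) := zpow_le_zpow_right₀ (by norm_num) (by omega)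
    rw [zpow_add₀ (by norm_num), zpow_one] at this
    linarith [hi.2, hi'.1]
  have hsort : (A.sort (· ≥ ·)).Pairwise (fun a b => b < a) := (A.sortedGT_sort).pairwise
  have := chain8 p hp t ((A.sort (· ≥ ·)).map ρ) u (2 * |u k|) (by positivity) ?_ ?_
  · simpa using this
  · intro i hi
    simp only [List.mem_map, Finset.mem_sort] at hi
    obtain ⟨a, ha, rfl⟩ := hi
    exact key j a k _ hk (hρ a ha) (hA a ha).2.1 (hA a ha).2.2
  · rw [List.pairwise_map]
    refine hsort.imp_of_mem ?_
    intro a b ha hb hab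
    rw [Finset.mem_sort] at ha hb
    exact key a b _ _ (hρ a ha) (hρ b hb) hab (by rw [(hA a ha).2.2, (hA b hb).2.2])

lemma count8 (J : Finset ℤ) (R : ℕ) :
    (J.filter fun j => (J.filter fun a => a < j ∧ a % 2 = j % 2).card < R).card ≤ 2 * R := by
  have h : (J.filter fun j => (J.filter fun a => a < j ∧ a % 2 = j % 2).card < R).card ≤
      (Finset.range R ×ˢ ({0, 1} : Finset ℤ)).card := by
    refine Finset.card_le_card_of_injOn
      (fun j => ((J.filter fun a => a < j ∧ a % 2 = j % 2).card, j % 2)) ?_ ?_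
    · intro j hj
      simp only [Finset.coe_filter, Set.mem_ofPred_eq] at hj
      simp only [Finset.coe_product, Set.mem_prod, Finset.mem_coe, Finset.mem_range, Finset.mem_insert,
        Finset.mem_singleton]
      refine ⟨hj.2, by omega⟩
    · have aux : ∀ a ∈ J, ∀ b ∈ J, a % 2 = b % 2 → a < b →
          (J.filter fun x => x < a ∧ x % 2 = a % 2).card < (J.filter fun x => x < b ∧ x % 2 = b % 2).card := by
        intro a ha b hb hab hlt
        refine Finset.card_lt_card (Finset.ssubset_iff_of_subset ?_ |>.2 ⟨a, ?_, ?_⟩)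
        · intro x hx
          simp only [Finset.mem_filter] at hx ⊢
          exact ⟨hx.1, by omega, by omega⟩
        · simp only [Finset.mem_filter]; exact ⟨ha, hlt, hab⟩
        · simp
      intro a ha b hb hab
      simp only [Finset.coe_filter, Set.mem_ofPred_eq] at ha hb
      simp only [Prod.mk.injEq] at hab
      rcases lt_trichotomy a b with h | h | h
      · have := aux a ha.1 b hb.1 hab.2 h; omega
      · exact h
      · have := aux b hb.1 a ha.1 hab.2.symm h; omega
  refine h.trans (le_of_eq ?_)
  rw [Finset.card_product]; simp [mul_comm]

lemma idx8 {n : ℕ} (u : Fin n → ℝ) : ∃ J : Finset ℤ, ∀ j, j ∈ J ↔ (binClass u j).Nonempty := by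
  have : {j | (binClass u j).Nonempty}.Finite := by
    refine Set.Finite.subset (s := ⋃ k, {j | k ∈ binClass u j}) (Set.finite_iUnion fun k => ?_) ?_
    · exact Set.Subsingleton.finite fun a ha b hb => class8_unique u k a b ha hb
    · rintro j ⟨k, hk⟩
      simp only [Set.mem_iUnion]
      exact ⟨k, hk⟩
  exact ⟨this.toFinset, by simp⟩

lemma main8 {n m : ℕ} (hn : 2 ≤ n) (hm : 2 ≤ m) (v : Fin m → Fin n → ℝ) (z : Fin m) (t : ℝ) :
    ∑ k : Fin n, biasJoint n m v {q | |(∑ i, v z i * q.2 i) - t| < 2 * |v z k|} ≤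
      ENNReal.ofReal (8000 * Real.sqrt m * Real.log n ^ 2) := by
  have hn' : (2 : ℝ) ≤ n := by exact_mod_cast hn
  have hm' : (2 : ℝ) ≤ m := by exact_mod_cast hm
  set L := Real.log n with hLd
  have hL : 1 / 2 ≤ L := by
    have := Real.log_two_gt_d9
    have h2 := Real.log_le_log (by norm_num) hn'
    linarith
  set u := v z with hu
  obtain ⟨J, hJ⟩ := idx8 u
  set R := ⌈4 * L⌉₊ with hR
  have hR1 : 4 * L ≤ R := Nat.le_ceil _
  have hR2 : (R : ℝ) ≤ 6 * L := by
    have := Nat.ceil_lt_add_one (show 0 ≤ 4 * L by linarith)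
    linarith
  set E := J.filter fun j => (J.filter fun a => a < j ∧ a % 2 = j % 2).card < R with hE
  set b : Fin n → ENNReal := fun k => biasJoint n m v {q | |(∑ i, u i * q.2 i) - t| < 2 * |u k|} with hb
  have hpow : (3 / 4 : ℝ) ^ R ≤ 1 / n := by
    have h1 : (3 / 4 : ℝ) ≤ Real.exp (-(1 / 4)) := by
      have := Real.add_one_le_exp (-(1 / 4) : ℝ); linarith
    calc (3 / 4 : ℝ) ^ R ≤ Real.exp (-(1 / 4)) ^ R := by gcongr
      _ = Real.exp (R * -(1 / 4)) := (Real.exp_nat_mul _ _).symm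
      _ ≤ Real.exp (-L) := Real.exp_le_exp.2 (by linarith)
      _ = 1 / n := by rw [Real.exp_neg, hLd, Real.exp_log (by linarith), one_div]
  have hlate : ∀ k, k ∉ E.biUnion (binClass u) → b k ≤ ENNReal.ofReal (2 / n) := by
    intro k hk
    refine (joint8_le hn hm v u t _).trans ?_
    rw [show (2 : ENNReal) = ENNReal.ofReal 2 by simp, show (2 / n : ℝ) = 2 * (1 / n) by ring,
      ENNReal.ofReal_mul (by norm_num)]
    gcongr
    refine Q8_le v u t _ _ fun p hp => ?_
    by_cases h0 : u k = 0
    · have : pr8 p u t (2 * |u k|) = 0 := by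
        unfold pr8
        refine Finset.sum_eq_zero fun s _ => ?_
        rw [if_neg, mul_zero]
        rw [h0]; simp
      rw [this]; positivity
    · obtain ⟨j, hj⟩ := class8_exists u k h0
      have hjJ : j ∈ J := (hJ j).2 ⟨k, hj⟩
      have hjE : j ∉ E := fun h => hk (Finset.mem_biUnion.2 ⟨j, h, hj⟩)
      have hcard : R ≤ (J.filter fun a => a < j ∧ a % 2 = j % 2).card := by
        by_contra hlt
        exact hjE (Finset.mem_filter.2 ⟨hjJ, not_le.1 hlt⟩)
      refine (late8 u p hp t j k hj (J.filter fun a => a < j ∧ a % 2 = j % 2) ?_).trans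
        ((pow_le_pow_of_le_one (by norm_num) (by norm_num) hcard).trans hpow)
      intro a ha
      rw [Finset.mem_filter] at ha
      exact ⟨(hJ a).1 ha.1, ha.2⟩
  have hearly : ∀ j ∈ E, ∑ k ∈ binClass u j, b k ≤ ENNReal.ofReal (320 * Real.sqrt (m * L)) := by
    intro j hj
    have hne := (hJ j).1 (Finset.mem_filter.1 hj).1
    calc ∑ k ∈ binClass u j, b k ≤ ∑ k ∈ binClass u j, 2 * Q8 v u t (2 * 2 ^ (-j)) := by
          refine Finset.sum_le_sum fun k hk => (joint8_le hn hm v u t _).trans ?_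
          gcongr
          refine Q8_mono v u t _ _ ?_
          simp only [binClass, Finset.mem_filter, Finset.mem_univ, true_and] at hk
          linarith [hk.2]
      _ = 2 * (((binClass u j).card : ENNReal) * Q8 v u t (2 * 2 ^ (-j))) := by
          rw [Finset.sum_const, nsmul_eq_mul]; ring
      _ ≤ 2 * ENNReal.ofReal (160 * Real.sqrt (m * L)) := by
          gcongr
          exact early8 hn hm v z t j hne
      _ = ENNReal.ofReal (320 * Real.sqrt (m * L)) := by
          rw [show (2 : ENNReal) = ENNReal.ofReal 2 by simp, ← ENNReal.ofReal_mul (by norm_num)]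
          congr 1; ring
  have hsum : ∑ k, b k ≤ ENNReal.ofReal 2 + ENNReal.ofReal (12 * L * (320 * Real.sqrt (m * L))) := by
    rw [← Finset.sum_sdiff (Finset.subset_univ (E.biUnion (binClass u)))]
    refine add_le_add ?_ ?_
    · calc ∑ k ∈ Finset.univ \ E.biUnion (binClass u), b k
          ≤ ∑ k ∈ Finset.univ \ E.biUnion (binClass u), ENNReal.ofReal (2 / n) :=
            Finset.sum_le_sum fun k hk => hlate k (Finset.mem_sdiff.1 hk).2
        _ ≤ ∑ k : Fin n, ENNReal.ofReal (2 / n) :=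
            Finset.sum_le_sum_of_subset Finset.sdiff_subset
        _ = ENNReal.ofReal 2 := by
            rw [Finset.sum_const, Finset.card_univ, Fintype.card_fin, nsmul_eq_mul,
              ← ENNReal.ofReal_natCast, ← ENNReal.ofReal_mul (by positivity)]
            congr 1; field_simp
    · rw [Finset.sum_biUnion]
      · calc ∑ j ∈ E, ∑ k ∈ binClass u j, b k ≤ ∑ j ∈ E, ENNReal.ofReal (320 * Real.sqrt (m * L)) :=
              Finset.sum_le_sum hearly
          _ = ENNReal.ofReal (E.card * (320 * Real.sqrt (m * L))) := by
              rw [Finset.sum_const, nsmul_eq_mul, ENNReal.ofReal_mul (p := (E.card : ℝ)) (by positivity),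
                ENNReal.ofReal_natCast]
          _ ≤ _ := by
              refine ENNReal.ofReal_le_ofReal (mul_le_mul_of_nonneg_right ?_ (by positivity))
              have : (E.card : ℝ) ≤ 2 * R := by exact_mod_cast count8 J R
              linarith
      · intro a _ a' _ haa
        refine Finset.disjoint_left.2 fun k hk hk' => haa (class8_unique u k a a' hk hk')
  refine hsum.trans ?_
  rw [← ENNReal.ofReal_add (by norm_num) (by positivity)]
  refine ENNReal.ofReal_le_ofReal ?_
  rw [Real.sqrt_mul (by positivity)]
  have hsL : Real.sqrt L ≤ 2 * L := by
    rw [Real.sqrt_le_left (by positivity)]; nlinarith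
  have hsm : 1 ≤ Real.sqrt m := by
    rw [Real.one_le_sqrt]; linarith
  have h1 : L * (Real.sqrt m * Real.sqrt L) ≤ 2 * (Real.sqrt m * L ^ 2) := by
    have : L * Real.sqrt m * Real.sqrt L ≤ L * Real.sqrt m * (2 * L) := by gcongr
    linarith
  have h2 : 1 ≤ 4 * (Real.sqrt m * L ^ 2) := by
    have : 1 ≤ 4 * L ^ 2 := by nlinarith
    nlinarith
  linarith

/-- Lemma 2.13: there is an absolute constant `C > 0` such that for all
`n, m ≥ 2` and unit vectors `v̄_1, …, v̄_m ∈ ℝ^n`, if `P` is the random bias vector of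
Definition 2.2 conditioned on `‖P‖_∞ ≤ 1/2` and `x ~ μ_P`, then for `v = v̄_1` and every
`t ∈ ℝ`, `∑_{k=1}^n Pr[|⟨v,x⟩ - t| < 2|v_k|] ≤ C·√m·(log n)²` (the probability being
over both `P` and `x ~ μ_P`). -/
theorem stmt_8 :
    ∃ C : ℝ, 0 < C ∧
      ∀ (n m : ℕ) (hn : 2 ≤ n) (hm : 2 ≤ m)
        (v : Fin m → Fin n → ℝ) (hv : ∀ ℓ, ∑ i, v ℓ i ^ 2 = 1) (t : ℝ),
        ∑ k : Fin n,
            biasJoint n m v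
              {q | |(∑ i, v ⟨0, by omega⟩ i * q.2 i) - t| < 2 * |v ⟨0, by omega⟩ k|} ≤
          ENNReal.ofReal (C * Real.sqrt m * Real.log n ^ 2) := by
  exact ⟨8000, by norm_num, fun n m hn hm v _ t => main8 hn hm v ⟨0, by omega⟩ t⟩
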